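/- arXiv:0811.1373 — 3 statements merged into one kernel-verified Lean document; each statement's English description precedes it below -/
import Mathlib

section
/- Let K be a field of characteristic zero, let t ≥ 1 and d ≥ 1, let v_1, …, v_t ∈ K^d be pairwise distinct points, and let w_q^{(0)}, w_q^{(1)}, …, w_q^{(d)} ∈ K be arbitrary scalars for 1 ≤ q ≤ t. Then there exists a polynomial A ∈ K[X_1, …, X_d] with total degree deg(A) < 2td such that A(v_q) = w_q^{(0)} and ∂A/∂X_i(v_q) = w_q^{(i)} for all 1 ≤ q ≤ t and 1 ≤ i ≤ d. -/
open MvPolynomial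

/-- A Lagrange-type polynomial that is `1` at `v q` and `0` at the other points. -/
theorem lagrange_aux {K : Type*} [Field K]
    (t d : ℕ) (hd : 1 ≤ d) (v : Fin t → (Fin d → K)) (hv : Function.Injective v) (q : Fin t) :
    ∃ M : MvPolynomial (Fin d) K, M.totalDegree ≤ t - 1 ∧ eval (v q) M = 1 ∧
      ∀ r, r ≠ q → eval (v r) M = 0 := by
  have h : ∀ r, r ≠ q → ∃ j, v q j ≠ v r j := by
    intro r hr
    by_contra! hc
    exact hr (hv (funext hc)).symm
  haveI : Nonempty (Fin d) := ⟨⟨0, hd⟩⟩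
  choose! j hj using h
  refine ⟨∏ r ∈ Finset.univ.erase q,
    (C (v q (j r) - v r (j r))⁻¹ * (X (j r) - C (v r (j r)))), ?_, ?_, ?_⟩
  · refine (totalDegree_finset_prod _ _).trans ?_
    refine (Finset.sum_le_card_nsmul _ _ 1 ?_).trans ?_
    · intro r _
      refine (totalDegree_mul _ _).trans ?_
      rw [totalDegree_C, zero_add]
      exact (totalDegree_sub_C_le _ _).trans (totalDegree_X _).le
    · simp [Finset.card_erase_of_mem]
  · rw [map_prod]
    refine Finset.prod_eq_one fun r hr => ?_
    have := sub_ne_zero.2 (hj r (Finset.ne_of_mem_erase hr))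
    simp [inv_mul_cancel₀ this]
  · intro r hr
    rw [map_prod]
    exact Finset.prod_eq_zero (Finset.mem_erase.2 ⟨hr, Finset.mem_univ _⟩) (by simp)

/-- First-order Hermite interpolation for multivariate polynomials over a field of
characteristic zero, with the explicit degree bound `deg A < 2td`. -/
theorem hermite_interpolation {K : Type*} [Field K] [CharZero K]
    (t d : ℕ) (ht : 1 ≤ t) (hd : 1 ≤ d)
    (v : Fin t → (Fin d → K)) (hv : Function.Injective v)
    (w0 : Fin t → K) (w : Fin t → Fin d → K) :
    ∃ A : MvPolynomial (Fin d) K, A.totalDegree < 2 * t * d ∧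
      (∀ q : Fin t, eval (v q) A = w0 q) ∧
      (∀ q : Fin t, ∀ i : Fin d, eval (v q) (pderiv i A) = w q i) := by
  choose M hM1 hM2 hM3 using lagrange_aux t d hd v hv
  let c : Fin t → Fin d → K := fun q i => w q i - w0 q * (2 * eval (v q) (pderiv i (M q)))
  let N : Fin t → MvPolynomial (Fin d) K := fun q =>
    C (w0 q) + ∑ i, C (c q i) * (X i - C (v q i))
  have hN0 : ∀ q, eval (v q) (N q) = w0 q := by
    intro q
    simp [N]
  have hN1 : ∀ q i, eval (v q) (pderiv i (N q)) = c q i := by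
    intro q i
    simp [N, pderiv_X, Pi.single_apply]
  have hNd : ∀ q, (N q).totalDegree ≤ 1 := by
    intro q
    refine (totalDegree_add _ _).trans (max_le (by simp) ?_)
    refine totalDegree_finsetSum_le fun i _ => ?_
    refine (totalDegree_mul _ _).trans ?_
    rw [totalDegree_C, zero_add]
    exact (totalDegree_sub_C_le _ _).trans (totalDegree_X _).le
  refine ⟨∑ q, M q * M q * N q, ?_, ?_, ?_⟩
  · have h1 : (∑ q, M q * M q * N q).totalDegree ≤ 2 * t - 1 := by
      refine totalDegree_finsetSum_le fun q _ => ?_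
      have h1 := totalDegree_mul (M q * M q) (N q)
      have h2 := totalDegree_mul (M q) (M q)
      have := hM1 q
      have := hNd q
      omega
    have : 2 * t * 1 ≤ 2 * t * d := Nat.mul_le_mul_left _ hd
    omega
  · intro q
    rw [map_sum, Finset.sum_eq_single q]
    · simp [hM2, hN0]
    · intro r _ hr
      simp [hM3 r q hr.symm]
    · simp
  · intro q i
    rw [map_sum, map_sum, Finset.sum_eq_single q]
    · simp only [pderiv_mul, map_add, map_mul, hM2, hN0, hN1, c]
      ring
    · intro r _ hr
      simp [hM3 r q hr.symm]
    · simp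
end

section
/- Let K be a field of characteristic zero and let f̃ be the polynomial function on K⁵ given by f̃(u,v,w,x,y) = u·x² + 2·w²·x·y + v·y². Then Sing(f̃) = { (u,v,w,x,y) ∈ K⁵ : x = 0 and y = 0 }. -/
open MvPolynomial

/-- `Sing f` is the set of points `p` with `f p = 0` at which all first-order partial
derivatives of `f` vanish. -/
def Sing {K : Type*} [CommRing K] {σ : Type*} (f : MvPolynomial σ K) : Set (σ → K) :=
  { p | eval p f = 0 ∧ ∀ i : σ, eval p (pderiv i f) = 0 }

/-- For `f̃(u,v,w,x,y) = u·x² + 2·w²·x·y + v·y²` (coordinates `u=0, v=1, w=2, x=3, y=4`),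
the singular locus is `{x = y = 0}`. -/
theorem sing_ftilde (K : Type*) [Field K] [CharZero K] :
    Sing ((X 0 * X 3 ^ 2 + 2 * X 2 ^ 2 * X 3 * X 4 + X 1 * X 4 ^ 2 :
        MvPolynomial (Fin 5) K)) =
      { p : Fin 5 → K | p 3 = 0 ∧ p 4 = 0 } := by
  have h2 : ∀ i : Fin 5, pderiv i (2 : MvPolynomial (Fin 5) K) = 0 := fun i => by
    have := pderiv_C (R := K) (i := i) (a := 2)
    rwa [map_ofNat] at this
  ext p
  simp only [Sing, Set.mem_ofPred_eq]
  constructor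
  · rintro ⟨-, h⟩
    have h0 := h 0
    have h1 := h 1
    simp [pderiv_X, Derivation.leibniz, Derivation.leibniz_pow, h2] at h0 h1
    exact ⟨h0, h1⟩
  · rintro ⟨h3, h4⟩
    refine ⟨by simp [h3, h4], fun i => ?_⟩
    simp [Derivation.leibniz, Derivation.leibniz_pow, h2, h3, h4]
end

section
/- Let K be a field of characteristic zero and let n ≥ 1. In the 4n+1 variables x_1,…,x_n, y_1,…,y_n, u_1,…,u_n, v_1,…,v_n, w define polynomials recursively by q_1 = u_1·x_1² + 2·w·x_1·y_1 + v_1·y_1² and q_{k+1} = u_{k+1}·x_{k+1}² + 2·q_k·x_{k+1}·y_{k+1} + v_{k+1}·y_{k+1}² for 1 ≤ k ≤ n−1, and set f_n = q_n. Then Sing(f_n) = { points of K^{4n+1} with x_n = 0 and y_n = 0 }. -/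
open MvPolynomial

/-- Index type for the `4n+1` variables `x_k, y_k, u_k, v_k` (`k = 1, …, n`, here `0`-indexed)
and `w`. -/
abbrev Var (n : ℕ) := (Fin 4 × Fin n) ⊕ Unit

def xv {n : ℕ} (k : Fin n) : Var n := Sum.inl (0, k)
def yv {n : ℕ} (k : Fin n) : Var n := Sum.inl (1, k)
def uv {n : ℕ} (k : Fin n) : Var n := Sum.inl (2, k)
def vv {n : ℕ} (k : Fin n) : Var n := Sum.inl (3, k)
def wv {n : ℕ} : Var n := Sum.inr ()

theorem sing_aux {K : Type*} [Field K] {n : ℕ} (j : Fin n) (g : MvPolynomial (Var n) K)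
    (hu : pderiv (uv j) g = 0) (hv : pderiv (vv j) g = 0) :
    Sing (X (uv j) * X (xv j) ^ 2 + 2 * g * X (xv j) * X (yv j) + X (vv j) * X (yv j) ^ 2) =
      { p : Var n → K | p (xv j) = 0 ∧ p (yv j) = 0 } := by
  have two : ∀ i, pderiv i (2 : MvPolynomial (Var n) K) = 0 := fun i => by
    have h := (pderiv (R := K) i).map_natCast 2
    exact_mod_cast h
  ext p
  simp only [Sing, Set.mem_setOf_eq]
  constructor
  · rintro ⟨-, h⟩
    simp only [uv] at hu
    simp only [vv] at hv
    have h1 := h (uv j)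
    have h2 := h (vv j)
    simp [Derivation.leibniz, pderiv_X, Pi.single_apply, hu, hv, two, uv, vv, xv, yv] at h1 h2
    exact ⟨h1, h2⟩
  · rintro ⟨hx, hy⟩
    refine ⟨by simp [hx, hy], fun i => ?_⟩
    simp [Derivation.leibniz, Derivation.leibniz_pow, hx, hy]

theorem pderiv_aux {K : Type*} [Field K] {n : ℕ} (i k : Fin n) (hik : i ≠ k) (c : Fin 4)
    (g : MvPolynomial (Var n) K) (hg : pderiv (Sum.inl (c, i)) g = 0) :
    pderiv (Sum.inl (c, i) : Var n) (X (uv k) * X (xv k) ^ 2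
      + 2 * g * X (xv k) * X (yv k) + X (vv k) * X (yv k) ^ 2) = 0 := by
  have two : ∀ i, pderiv i (2 : MvPolynomial (Var n) K) = 0 := fun i => by
    have h := (pderiv (R := K) i).map_natCast 2
    exact_mod_cast h
  simp [Derivation.leibniz, pderiv_X, Pi.single_apply, hg, two, uv, vv, xv, yv, hik, hik.symm]

/-- With `Q k = q_{k+1}` defined by the recursion
`q_1 = u_1 x_1² + 2 w x_1 y_1 + v_1 y_1²`,
`q_{k+1} = u_{k+1} x_{k+1}² + 2 q_k x_{k+1} y_{k+1} + v_{k+1} y_{k+1}²`,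
the polynomial `f_n = q_n = Q (n-1)` has `Sing(f_n) = {x_n = y_n = 0}`. -/
theorem sing_fn (K : Type*) [Field K] [CharZero K] (n : ℕ) (hn : 1 ≤ n)
    (Q : ℕ → MvPolynomial (Var n) K)
    (hQ0 : Q 0 = X (uv ⟨0, hn⟩) * X (xv ⟨0, hn⟩) ^ 2
        + 2 * X wv * X (xv ⟨0, hn⟩) * X (yv ⟨0, hn⟩)
        + X (vv ⟨0, hn⟩) * X (yv ⟨0, hn⟩) ^ 2)
    (hQsucc : ∀ k : ℕ, ∀ h : k + 1 < n,
      Q (k + 1) = X (uv ⟨k + 1, h⟩) * X (xv ⟨k + 1, h⟩) ^ 2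
        + 2 * Q k * X (xv ⟨k + 1, h⟩) * X (yv ⟨k + 1, h⟩)
        + X (vv ⟨k + 1, h⟩) * X (yv ⟨k + 1, h⟩) ^ 2) :
    Sing (Q (n - 1)) =
      { p : Var n → K | p (xv ⟨n - 1, Nat.sub_lt hn Nat.one_pos⟩) = 0 ∧
          p (yv ⟨n - 1, Nat.sub_lt hn Nat.one_pos⟩) = 0 } := by
  have key : ∀ k : ℕ, k < n → ∀ i : Fin n, k < i.1 → ∀ c : Fin 4,
      pderiv (Sum.inl (c, i) : Var n) (Q k) = 0 := by
    intro k
    induction k with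
    | zero =>
      intro _ i hi c
      rw [hQ0]
      refine pderiv_aux i _ (fun h => ?_) c _ ?_
      · rw [h] at hi
        exact lt_irrefl _ hi
      · simp [pderiv_X, wv]
    | succ k ih =>
      intro hk i hi c
      rw [hQsucc k hk]
      refine pderiv_aux i _ (fun h => ?_) c _ (ih (by omega) i (by omega) c)
      rw [h] at hi
      exact lt_irrefl _ hi
  obtain ⟨m, rfl⟩ : ∃ m, n = m + 1 := ⟨n - 1, by omega⟩
  cases m with
  | zero =>
    change Sing (Q 0) = _
    rw [hQ0]
    exact sing_aux _ _ (by simp [pderiv_X, wv, uv]) (by simp [pderiv_X, wv, vv])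
  | succ m =>
    change Sing (Q (m + 1)) = _
    rw [hQsucc m (by omega)]
    exact sing_aux _ _ (key m (by omega) _ (by simp) 2) (key m (by omega) _ (by simp) 3)
end
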